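/- Let h₁, h₂ ∈ H ⊆ G with h₁ ≠ h₂. For every nonempty finite word γ over X, the two conditions h₁·γ = h₂·γ and ρ*(h₁, γ) = ρ*(h₂, γ) hold simultaneously if and only if the first letter of γ belongs to Y; moreover, in that case h₁·γ = h₂·γ = γ and ρ*(h₁, γ) = ρ*(h₂, γ) = 1_G. -/

import Mathlib

/-- The group `G = H × F(a,b) × ℤ × ℤ` (with `ℤ` written multiplicatively so that the product
carries a group structure). The free group on two generators is `FreeGroup Bool`, with
generators `a = .of false` and `b = .of true`. -/
abbrev GG (H : Type) : Type := H × FreeGroup Bool × Multiplicative ℤ × Multiplicative ℤ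

/-- The group `K = H × F(a,b) × ℤ`. -/
abbrev KK (H : Type) : Type := H × FreeGroup Bool × Multiplicative ℤ

/-- `π₁ : G → K`, `(h,f,n,m) ↦ (h,f,n)`. -/
def pi1 {H : Type} (g : GG H) : KK H := (g.1, g.2.1, g.2.2.1)

/-- `π₂ : G → K`, `(h,f,n,m) ↦ (h,f,m)`. -/
def pi2 {H : Type} (g : GG H) : KK H := (g.1, g.2.1, g.2.2.2)

/-- `ζ₁ : G → ℤ`, `(h,f,n,m) ↦ n`. -/
def zeta1 {H : Type} (g : GG H) : ℤ := Multiplicative.toAdd g.2.2.1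

/-- `ζ₂ : G → ℤ`, `(h,f,n,m) ↦ m`. -/
def zeta2 {H : Type} (g : GG H) : ℤ := Multiplicative.toAdd g.2.2.2

/-- The exponent sum of the generator `i` in an element of the free group on two generators. -/
def expSum (i : Bool) : FreeGroup Bool →* Multiplicative ℤ :=
  FreeGroup.lift (fun j => Multiplicative.ofAdd (if j = i then (1 : ℤ) else 0))

/-- `τ : G → G`, `(h,f,n,m) ↦ (1,1,|f|_a,|f|_b)`, the abelianization of `F` in `G`. -/
def tau {H : Type} [Group H] (g : GG H) : GG H :=
  (1, 1, expSum false g.2.1, expSum true g.2.1)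

/-- The alphabet `X = Y ⊔ Z`, `Y = {yⁱ_n : n ∈ ℤ}`, `Z = {zⁱ_k : k ∈ K}`, `i ∈ {1,2}`
(`i = 1` encoded as `false`, `i = 2` as `true`). -/
inductive Letter (H : Type) : Type
  | y : Bool → ℤ → Letter H
  | z : Bool → KK H → Letter H

/-- The letter action `α : G × X → X`:
`α(g, yⁱ_n) = yⁱ_{ζᵢ(g)+n}` and `α(g, zⁱ_k) = zⁱ_{πᵢ(g)·k}`. -/
def actL {H : Type} [Group H] (g : GG H) : Letter H → Letter H
  | Letter.y false n => Letter.y false (zeta1 g + n)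
  | Letter.y true n => Letter.y true (zeta2 g + n)
  | Letter.z false k => Letter.z false (pi1 g * k)
  | Letter.z true k => Letter.z true (pi2 g * k)

/-- The restriction `ρ : G × X → G`: `ρ(g, yⁱ_n) = τ(g)` and `ρ(g, zⁱ_k) = 1`. -/
def resL {H : Type} [Group H] (g : GG H) : Letter H → GG H
  | Letter.y _ _ => tau g
  | Letter.z _ _ => 1

/-- The action of `G` on finite words over `X`:
`g·ε = ε` and `g·(x w) = α(g,x) (ρ(g,x)·w)`. -/
def wact {H : Type} [Group H] : GG H → List (Letter H) → List (Letter H)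
  | _, [] => []
  | g, x :: w => actL g x :: wact (resL g x) w

/-- The restriction of `g ∈ G` along a word: `ρ*(g,ε) = g`, `ρ*(g, x w) = ρ*(ρ(g,x), w)`. -/
def wres {H : Type} [Group H] : GG H → List (Letter H) → GG H
  | g, [] => g
  | g, x :: w => wres (resL g x) w

theorem tau_of_snd_eq_one {H : Type} [Group H] (h : H) : tau ((h, 1, 1, 1) : GG H) = 1 := by
  simp [tau]

theorem actL_one {H : Type} [Group H] (x : Letter H) : actL (1 : GG H) x = x := by
  have h₁ : pi1 (1 : GG H) = 1 := rfl
  have h₂ : pi2 (1 : GG H) = 1 := rfl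
  rcases x with ⟨_ | _, n⟩ | ⟨_ | _, k⟩ <;> simp [actL, zeta1, zeta2, h₁, h₂]

theorem resL_one {H : Type} [Group H] (x : Letter H) : resL (1 : GG H) x = 1 := by
  cases x with
  | y i n => exact tau_of_snd_eq_one 1
  | z i k => rfl

theorem wact_one {H : Type} [Group H] (w : List (Letter H)) : wact (1 : GG H) w = w := by
  induction w with
  | nil => rfl
  | cons x w ih => rw [wact, actL_one, resL_one, ih]

theorem wres_one {H : Type} [Group H] (w : List (Letter H)) : wres (1 : GG H) w = 1 := by
  induction w with
  | nil => rfl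
  | cons x w ih => rw [wres, resL_one, ih]

theorem wact_cons_y {H : Type} [Group H] (h : H) (i : Bool) (n : ℤ) (w : List (Letter H)) :
    wact ((h, 1, 1, 1) : GG H) (Letter.y i n :: w) = Letter.y i n :: w := by
  rw [wact, resL, tau_of_snd_eq_one, wact_one]
  cases i <;> simp [actL, zeta1, zeta2]

theorem wres_cons_y {H : Type} [Group H] (h : H) (i : Bool) (n : ℤ) (w : List (Letter H)) :
    wres ((h, 1, 1, 1) : GG H) (Letter.y i n :: w) = 1 := by
  rw [wres, resL, tau_of_snd_eq_one, wres_one]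

theorem eq_of_actL_z_eq {H : Type} [Group H] {h₁ h₂ : H} {i : Bool} {k : KK H}
    (h : actL ((h₁, 1, 1, 1) : GG H) (Letter.z i k) = actL ((h₂, 1, 1, 1) : GG H) (Letter.z i k)) :
    h₁ = h₂ := by
  cases i <;> simpa [actL, pi1, pi2] using h

/-- For distinct `h₁, h₂ ∈ H ⊆ G` and any nonempty word `γ` over `X`: `h₁·γ = h₂·γ` together
with `ρ*(h₁,γ) = ρ*(h₂,γ)` holds iff the first letter of `γ` lies in `Y`; in that case
`h₁·γ = h₂·γ = γ` and `ρ*(h₁,γ) = ρ*(h₂,γ) = 1`. -/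
theorem stmt8 (H : Type) [Group H] (h₁ h₂ : H) (hne : h₁ ≠ h₂) :
    ∀ γ : List (Letter H), γ ≠ [] →
      ((wact ((h₁, 1, 1, 1) : GG H) γ = wact ((h₂, 1, 1, 1) : GG H) γ ∧
          wres ((h₁, 1, 1, 1) : GG H) γ = wres ((h₂, 1, 1, 1) : GG H) γ) ↔
        ∃ (i : Bool) (n : ℤ), γ.head? = some (Letter.y i n)) ∧
      ((∃ (i : Bool) (n : ℤ), γ.head? = some (Letter.y i n)) →
        wact ((h₁, 1, 1, 1) : GG H) γ = γ ∧ wact ((h₂, 1, 1, 1) : GG H) γ = γ ∧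
        wres ((h₁, 1, 1, 1) : GG H) γ = 1 ∧ wres ((h₂, 1, 1, 1) : GG H) γ = 1) := by
  intro γ hγ
  cases γ with
  | nil => exact absurd rfl hγ
  | cons x w =>
    cases x with
    | y i n => simp [wact_cons_y, wres_cons_y]
    | z i k =>
      refine ⟨⟨fun h => absurd (eq_of_actL_z_eq (List.cons.inj h.1).1) hne, ?_⟩, ?_⟩ <;> simp
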